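/- For every ν ≥ 0, the polynomial p_ν(x) := 8x⁶ − 3(8ν² + 1)x⁴ + 4ν²(6ν² − 1)x² − 8ν⁶ has exactly one root x*_ν in the interval (ν, ∞), and the derivative φup'_ν(x) is strictly positive for every x > x*_ν. -/

import Mathlib

/-- The lower bound for the phase of Bessel derivatives:
`φlo_ν(x) := √(x² − ν²) − ν·arccos(ν/x) + π/4`. -/
noncomputable def phiLo (ν x : ℝ) : ℝ :=
  Real.sqrt (x ^ 2 - ν ^ 2) - ν * Real.arccos (ν / x) + Real.pi / 4

/-- The upper bound for the phase of Bessel derivatives: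
`φup_ν(x) := φlo_ν(x) + (9x² − 2ν²)/(24(x² − ν²)^{3/2})`. -/
noncomputable def phiUp (ν x : ℝ) : ℝ :=
  phiLo ν x + (9 * x ^ 2 - 2 * ν ^ 2) / (24 * Real.sqrt (x ^ 2 - ν ^ 2) ^ 3)

/-- The polynomial `p_ν(x) := 8x⁶ − 3(8ν² + 1)x⁴ + 4ν²(6ν² − 1)x² − 8ν⁶`. -/
noncomputable def pPoly (ν x : ℝ) : ℝ :=
  8 * x ^ 6 - 3 * (8 * ν ^ 2 + 1) * x ^ 4 + 4 * ν ^ 2 * (6 * ν ^ 2 - 1) * x ^ 2 - 8 * ν ^ 6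

lemma pPoly_eq_cubic (ν x : ℝ) :
    pPoly ν x = 8 * (x ^ 2 - ν ^ 2) ^ 3 - 3 * (x ^ 2 - ν ^ 2) ^ 2
      - 10 * ν ^ 2 * (x ^ 2 - ν ^ 2) - 7 * ν ^ 4 := by
  unfold pPoly
  ring

/-- Past a point of `(ν, ∞)` where `p_ν` is nonnegative, `p_ν` is strictly positive. -/
lemma pPoly_pos_of_lt {ν x y : ℝ} (hν : 0 ≤ ν) (hx : ν < x) (hxy : x < y)
    (h : 0 ≤ pPoly ν x) : 0 < pPoly ν y := by
  rw [pPoly_eq_cubic] at h ⊢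
  have hs : 0 < x ^ 2 - ν ^ 2 := by nlinarith
  have hst : x ^ 2 - ν ^ 2 < y ^ 2 - ν ^ 2 := by nlinarith
  generalize x ^ 2 - ν ^ 2 = s at *
  generalize y ^ 2 - ν ^ 2 = t at *
  have ht : 0 < t := hs.trans hst
  have h1 : 0 < 3 * (s * t) ^ 2 * (t - s) := by
    have := sub_pos.2 hst
    positivity
  have h2 : 0 ≤ 10 * ν ^ 2 * (s * t) * (t ^ 2 - s ^ 2) := by
    have : 0 ≤ t ^ 2 - s ^ 2 := sub_nonneg.2 (by gcongr)
    positivity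
  have h3 : 0 ≤ 7 * ν ^ 4 * (t ^ 3 - s ^ 3) := by
    have : 0 ≤ t ^ 3 - s ^ 3 := sub_nonneg.2 (by gcongr)
    positivity
  have h4 : 0 ≤ t ^ 3 * (8 * s ^ 3 - 3 * s ^ 2 - 10 * ν ^ 2 * s - 7 * ν ^ 4) := by positivity
  refine pos_of_mul_pos_right (a := s ^ 3) ?_ (by positivity)
  nlinarith

lemma exists_pPoly_eq_zero (ν : ℝ) : ∃ x, ν < x ∧ pPoly ν x = 0 := by
  have hlt : ∀ s : ℝ, 0 < s → ν < √(ν ^ 2 + s) := fun s hs =>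
    Real.lt_sqrt_of_sq_lt (by linarith)
  have hsub : ∀ s : ℝ, 0 < s → √(ν ^ 2 + s) ^ 2 - ν ^ 2 = s := fun s hs => by
    rw [Real.sq_sqrt (by positivity)]
    ring
  have hcont : Continuous (pPoly ν) := by
    unfold pPoly
    fun_prop
  have hle : √(ν ^ 2 + 1 / 8) ≤ √(ν ^ 2 + (ν ^ 2 + 3)) :=
    Real.sqrt_le_sqrt (by nlinarith [sq_nonneg ν])
  have h0 : pPoly ν √(ν ^ 2 + 1 / 8) ≤ 0 := by
    rw [pPoly_eq_cubic, hsub _ (by norm_num)]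
    nlinarith [sq_nonneg ν, sq_nonneg (ν ^ 2)]
  have h1 : 0 ≤ pPoly ν √(ν ^ 2 + (ν ^ 2 + 3)) := by
    rw [pPoly_eq_cubic, hsub _ (by positivity)]
    ring_nf
    positivity
  obtain ⟨x, hx, hx0⟩ := intermediate_value_Icc hle hcont.continuousOn ⟨h0, h1⟩
  exact ⟨x, (hlt _ (by norm_num)).trans_le hx.1, hx0⟩

lemma hasDerivAt_sqrt_sq_sub_sq {ν x : ℝ} (h : 0 < x ^ 2 - ν ^ 2) :
    HasDerivAt (fun x => √(x ^ 2 - ν ^ 2)) (x / √(x ^ 2 - ν ^ 2)) x := by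
  refine (((hasDerivAt_pow 2 x).sub_const (ν ^ 2)).sqrt h.ne').congr_deriv ?_
  have := Real.sqrt_pos.2 h
  field_simp
  norm_num

lemma hasDerivAt_phiLo {ν x : ℝ} (hν : 0 ≤ ν) (hx : ν < x) :
    HasDerivAt (phiLo ν) (√(x ^ 2 - ν ^ 2) / x) x := by
  have hx0 : 0 < x := hν.trans_lt hx
  have hs : 0 < x ^ 2 - ν ^ 2 := by nlinarith
  have hr := Real.sqrt_pos.2 hs
  have hdiv : HasDerivAt (fun x => ν / x) (-ν / x ^ 2) x := by
    refine ((hasDerivAt_const x ν).div (hasDerivAt_id x) hx0.ne').congr_deriv ?_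
    simp
  have hne : ν / x ≠ -1 := by
    have : 0 ≤ ν / x := by positivity
    linarith
  have hne' : ν / x ≠ 1 := ((div_lt_one hx0).2 hx).ne
  have hsqrt : √(1 - (ν / x) ^ 2) = √(x ^ 2 - ν ^ 2) / x := by
    rw [show 1 - (ν / x) ^ 2 = (x ^ 2 - ν ^ 2) / x ^ 2 by field_simp,
      Real.sqrt_div hs.le, Real.sqrt_sq hx0.le]
  refine (((hasDerivAt_sqrt_sq_sub_sq hs).sub (((Real.hasDerivAt_arccos hne hne').comp x
    hdiv).const_mul ν)).add_const (Real.pi / 4)).congr_deriv ?_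
  rw [hsqrt]
  field_simp
  rw [Real.sq_sqrt hs.le]

lemma hasDerivAt_phiUp {ν x : ℝ} (hν : 0 ≤ ν) (hx : ν < x) :
    HasDerivAt (phiUp ν) (pPoly ν x / (8 * x * √(x ^ 2 - ν ^ 2) ^ 5)) x := by
  have hx0 : 0 < x := hν.trans_lt hx
  have hs : 0 < x ^ 2 - ν ^ 2 := by nlinarith
  have hr := Real.sqrt_pos.2 hs
  have hnum : HasDerivAt (fun x => 9 * x ^ 2 - 2 * ν ^ 2) (18 * x) x := by
    refine (((hasDerivAt_pow 2 x).const_mul 9).sub_const (2 * ν ^ 2)).congr_deriv ?_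
    norm_num
    ring
  refine ((hasDerivAt_phiLo hν hx).add (hnum.div
    (((hasDerivAt_sqrt_sq_sub_sq hs).pow 3).const_mul 24) ?_)).congr_deriv ?_
  · simp only [Pi.pow_apply]
    positivity
  have hsq := Real.sq_sqrt hs.le
  have hν2 : ν ^ 2 = x ^ 2 - √(x ^ 2 - ν ^ 2) ^ 2 := by linarith
  rw [pPoly_eq_cubic, show ν ^ 4 = (ν ^ 2) ^ 2 by ring]
  simp only [Pi.pow_apply]
  generalize √(x ^ 2 - ν ^ 2) = r at *
  rw [hν2]
  field_simp
  norm_num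
  ring

/-- For every `ν ≥ 0`, the polynomial `p_ν` has exactly one root `x*_ν` in `(ν, ∞)`, and
`φup_ν' > 0` on `(x*_ν, ∞)`. -/
theorem pPoly_unique_root_and_phiUp_deriv_pos (ν : ℝ) (hν : 0 ≤ ν) :
    ∃ xstar, ν < xstar ∧ pPoly ν xstar = 0 ∧ (∀ y, ν < y → pPoly ν y = 0 → y = xstar) ∧
      ∀ x, xstar < x → 0 < deriv (phiUp ν) x := by
  obtain ⟨z, hz, hz0⟩ := exists_pPoly_eq_zero ν
  refine ⟨z, hz, hz0, fun y hy hy0 => ?_, fun x hx => ?_⟩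
  · rcases lt_trichotomy y z with h | h | h
    · exact absurd hz0 (pPoly_pos_of_lt hν hy h hy0.ge).ne'
    · exact h
    · exact absurd hy0 (pPoly_pos_of_lt hν hz h hz0.ge).ne'
  · have hνx := hz.trans hx
    have hx0 : 0 < x := hν.trans_lt hνx
    have hr : 0 < √(x ^ 2 - ν ^ 2) := Real.sqrt_pos.2 (by nlinarith)
    have hp := pPoly_pos_of_lt hν hz hx hz0.ge
    rw [(hasDerivAt_phiUp hν hνx).deriv]
    positivity
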